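/- Let (f, D) be a solution of f'' = λ·f·m in integral form on I = (a,∞) with λ > 0, and suppose f is positive and nonincreasing on (a,∞). Set α₊ := lim_{x→∞} f(x). Then the following three conditions are equivalent: (1) α₊ = 0; (2) ∫_{(r,∞)} y m(dy) = ∞ for every r ∈ (a,∞); (3) λ ∫_{(x,∞)} (y − x) f(y) m(dy) = f(x) for every x ∈ (a,∞). -/

import Mathlib

open MeasureTheory Filter Set

/-- A pair `(f, D)` is a solution of `f'' = λ·f·m` in integral form on `S`:
`f y − f x = ∫_x^y D(t) dt` and `D y − D x = λ ∫_{(x,y]} f dm` for all `x ≤ y` in `S`. -/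
def IsIntegralSolution (m : MeasureTheory.Measure ℝ) (lam : ℝ) (S : Set ℝ)
    (f D : ℝ → ℝ) : Prop :=
  (∀ x ∈ S, ∀ y ∈ S, x ≤ y → f y - f x = ∫ t in x..y, D t) ∧
  (∀ x ∈ S, ∀ y ∈ S, x ≤ y → D y - D x = lam * ∫ t in Set.Ioc x y, f t ∂m)

lemma lintegral_Ioi_lintegral_Ioi (m : Measure ℝ) (x : ℝ) [SFinite (m.restrict (Ioi x))]
    {g : ℝ → ENNReal} (hg : AEMeasurable g (m.restrict (Ioi x))) :
    ∫⁻ t in Ioi x, ∫⁻ u in Ioi t, g u ∂m = ∫⁻ u in Ioi x, ENNReal.ofReal (u - x) * g u ∂m := by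
  have hset : MeasurableSet {p : ℝ × ℝ | p.1 < p.2} :=
    measurableSet_lt measurable_fst measurable_snd
  calc ∫⁻ t in Ioi x, ∫⁻ u in Ioi t, g u ∂m
      = ∫⁻ t in Ioi x, ∫⁻ u in Ioi x,
          {p : ℝ × ℝ | p.1 < p.2}.indicator (fun p ↦ g p.2) (t, u) ∂m := by
        refine setLIntegral_congr_fun measurableSet_Ioi fun t ht ↦ ?_
        have : ∀ u, {p : ℝ × ℝ | p.1 < p.2}.indicator (fun p ↦ g p.2) (t, u)
            = (Ioi t).indicator g u := fun u ↦ rfl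
        simp only [this]
        rw [lintegral_indicator measurableSet_Ioi, Measure.restrict_restrict measurableSet_Ioi,
          inter_eq_left.2 (Ioi_subset_Ioi (le_of_lt ht))]
    _ = ∫⁻ u in Ioi x, (∫⁻ t in Ioi x,
          {p : ℝ × ℝ | p.1 < p.2}.indicator (fun p ↦ g p.2) (t, u)) ∂m :=
        lintegral_lintegral_swap (hg.comp_snd.indicator hset)
    _ = ∫⁻ u in Ioi x, ENNReal.ofReal (u - x) * g u ∂m := by
        refine setLIntegral_congr_fun measurableSet_Ioi fun u hu ↦ ?_
        have : ∀ t, {p : ℝ × ℝ | p.1 < p.2}.indicator (fun p ↦ g p.2) (t, u)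
            = (Iio u).indicator (fun _ ↦ g u) t := fun t ↦ rfl
        simp only [this]
        rw [lintegral_indicator measurableSet_Iio, lintegral_const,
          Measure.restrict_restrict measurableSet_Iio, Measure.restrict_apply_univ,
          Iio_inter_Ioi, Real.volume_Ioo, mul_comm]

lemma tendsto_lintegral_Ioc_atTop (m : Measure ℝ) (g : ℝ → ENNReal) (x : ℝ) :
    Tendsto (fun y ↦ ∫⁻ u in Ioc x y, g u ∂m) atTop (nhds (∫⁻ u in Ioi x, g u ∂m)) := by
  have h := tendsto_measure_Iic_atTop ((m.withDensity g).restrict (Ioi x))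
  rw [Measure.restrict_apply_univ, withDensity_apply _ measurableSet_Ioi] at h
  refine h.congr fun y ↦ ?_
  rw [Measure.restrict_apply measurableSet_Iic, Iic_inter_Ioi,
    withDensity_apply _ measurableSet_Ioc]

lemma tendsto_lintegral_Ioi_atTop_zero (m : Measure ℝ) (g : ℝ → ENNReal) {r : ℝ}
    (h : ∫⁻ u in Ioi r, g u ∂m ≠ ⊤) :
    Tendsto (fun y ↦ ∫⁻ u in Ioi y, g u ∂m) atTop (nhds 0) := by
  have h0 : ⋂ y : ℝ, Ioi y = ∅ := by
    ext z
    simpa using ⟨z, le_rfl⟩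
  have := tendsto_measure_iInter_atTop (μ := m.withDensity g) (s := fun y : ℝ ↦ Ioi y)
    (fun y ↦ measurableSet_Ioi.nullMeasurableSet) (fun _ _ hxy ↦ Ioi_subset_Ioi hxy)
    ⟨r, by rwa [withDensity_apply _ measurableSet_Ioi]⟩
  rw [h0, measure_empty] at this
  exact this.congr fun y ↦ withDensity_apply _ measurableSet_Ioi

lemma sigmaFinite_restrict_Ioi {m : Measure ℝ} {a x : ℝ}
    (hm : ∀ K : Set ℝ, IsCompact K → K ⊆ Ioi a → m K < ⊤) (hx : a < x) :
    SigmaFinite (m.restrict (Ioi x)) := by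
  have : IsFiniteMeasureOnCompacts (m.restrict (Ioi x)) := ⟨fun K hK ↦ by
    rw [Measure.restrict_apply hK.measurableSet]
    exact (measure_mono (inter_subset_inter_right K Ioi_subset_Ici_self)).trans_lt
      (hm _ (hK.inter_right isClosed_Ici) fun y hy ↦ hx.trans_le hy.2)⟩
  infer_instance

namespace IsIntegralSolution

variable {m : Measure ℝ} {a lam : ℝ} {f D : ℝ → ℝ}

lemma monotoneOn (hsol : IsIntegralSolution m lam (Ioi a) f D) (hlam : 0 < lam)
    (hpos : ∀ x ∈ Ioi a, 0 < f x) : MonotoneOn D (Ioi a) := by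
  intro x hx y hy hxy
  have h := hsol.2 x hx y hy hxy
  have h0 : 0 ≤ ∫ t in Ioc x y, f t ∂m :=
    setIntegral_nonneg measurableSet_Ioc fun t ht ↦ (hpos t (lt_trans hx ht.1)).le
  nlinarith [mul_nonneg hlam.le h0]

lemma intervalIntegrable (hD : MonotoneOn D (Ioi a)) {x y : ℝ} (hx : a < x) (hxy : x ≤ y) :
    IntervalIntegrable D volume x y :=
  MonotoneOn.intervalIntegrable (hD.mono (by
    rw [uIcc_of_le hxy]
    exact fun z hz ↦ hx.trans_le hz.1))

lemma sub_le_mul (hsol : IsIntegralSolution m lam (Ioi a) f D) (hD : MonotoneOn D (Ioi a))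
    {x y : ℝ} (hx : a < x) (hxy : x ≤ y) : f y - f x ≤ D y * (y - x) := by
  have hy := hx.trans_le hxy
  rw [hsol.1 x hx y hy hxy]
  refine (intervalIntegral.integral_mono_on hxy (intervalIntegrable hD hx hxy)
    (intervalIntegrable_const (c := D y)) fun t ht ↦ hD (hx.trans_le ht.1) hy ht.2).trans_eq ?_
  simp [mul_comm]

lemma mul_le_sub (hsol : IsIntegralSolution m lam (Ioi a) f D) (hD : MonotoneOn D (Ioi a))
    {x y : ℝ} (hx : a < x) (hxy : x ≤ y) : D x * (y - x) ≤ f y - f x := by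
  have hy := hx.trans_le hxy
  rw [hsol.1 x hx y hy hxy]
  refine Eq.trans_le ?_ (intervalIntegral.integral_mono_on hxy
    (intervalIntegrable_const (c := D x)) (intervalIntegrable hD hx hxy)
    fun t ht ↦ hD hx (hx.trans_le ht.1) ht.1)
  simp [mul_comm]

lemma nonpos (hsol : IsIntegralSolution m lam (Ioi a) f D) (hD : MonotoneOn D (Ioi a))
    (hanti : AntitoneOn f (Ioi a)) {x : ℝ} (hx : a < x) : D x ≤ 0 := by
  have h1 := hsol.mul_le_sub hD hx (le_add_of_nonneg_right zero_le_one)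
  have h2 := hanti hx (show a < x + 1 by linarith) (by linarith)
  linarith

lemma tendsto_zero (hsol : IsIntegralSolution m lam (Ioi a) f D) (hD : MonotoneOn D (Ioi a))
    (hanti : AntitoneOn f (Ioi a)) (hpos : ∀ x ∈ Ioi a, 0 < f x) :
    Tendsto D atTop (nhds 0) := by
  have hx : a < a + 1 := by linarith
  have hlim : Tendsto (fun y ↦ -f (a + 1) / (y - (a + 1))) atTop (nhds 0) :=
    (tendsto_atTop_add_const_right _ (-(a + 1)) tendsto_id).const_div_atTop _
  refine tendsto_of_tendsto_of_tendsto_of_le_of_le' hlim tendsto_const_nhds ?_ ?_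
  · filter_upwards [eventually_gt_atTop (a + 1)] with y hy
    rw [div_le_iff₀ (sub_pos.2 hy)]
    have := hsol.sub_le_mul hD hx hy.le
    linarith [hpos y (hx.trans hy)]
  · filter_upwards [eventually_gt_atTop a] with y hy using hsol.nonpos hD hanti hy

lemma ofReal_neg_eq_lintegral (hsol : IsIntegralSolution m lam (Ioi a) f D) (hlam : 0 < lam)
    (hm : ∀ K : Set ℝ, IsCompact K → K ⊆ Ioi a → m K < ⊤)
    (hpos : ∀ x ∈ Ioi a, 0 < f x) (hanti : AntitoneOn f (Ioi a)) {x : ℝ} (hx : a < x) :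
    ENNReal.ofReal (-D x)
      = ENNReal.ofReal lam * ∫⁻ u in Ioi x, ENNReal.ofReal (f u) ∂m := by
  have hD := hsol.monotoneOn hlam hpos
  have h1 : Tendsto (fun y ↦ ENNReal.ofReal (D y - D x)) atTop (nhds (ENNReal.ofReal (-D x))) := by
    refine ENNReal.tendsto_ofReal ?_
    simpa using (hsol.tendsto_zero hD hanti hpos).sub_const (D x)
  refine tendsto_nhds_unique h1 ((ENNReal.Tendsto.const_mul
    (tendsto_lintegral_Ioc_atTop m _ x) (Or.inr ENNReal.ofReal_ne_top)).congr' ?_)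
  filter_upwards [eventually_ge_atTop x] with y hxy
  have hsub : Icc x y ⊆ Ioi a := fun z hz ↦ hx.trans_le hz.1
  have hint : IntegrableOn f (Icc x y) m :=
    (hanti.mono hsub).integrableOn_of_measure_ne_top (isLeast_Icc hxy) (isGreatest_Icc hxy)
      (hm _ isCompact_Icc hsub).ne measurableSet_Icc
  rw [hsol.2 x hx y (hx.trans_le hxy) hxy, ENNReal.ofReal_mul hlam.le,
    ofReal_integral_eq_lintegral_ofReal (hint.mono_set Ioc_subset_Icc_self)]
  exact ae_restrict_of_forall_mem measurableSet_Ioc fun u hu ↦ (hpos u (lt_trans hx hu.1)).le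

lemma ofReal_sub_eq_lintegral (hsol : IsIntegralSolution m lam (Ioi a) f D)
    (hD : MonotoneOn D (Ioi a)) (hanti : AntitoneOn f (Ioi a)) {α : ℝ}
    (hα : Tendsto f atTop (nhds α)) {x : ℝ} (hx : a < x) :
    ENNReal.ofReal (f x - α) = ∫⁻ t in Ioi x, ENNReal.ofReal (-D t) := by
  refine tendsto_nhds_unique (ENNReal.tendsto_ofReal (hα.const_sub (f x)))
    ((tendsto_lintegral_Ioc_atTop volume _ x).congr' ?_)
  filter_upwards [eventually_ge_atTop x] with y hxy
  have h : f x - f y = ∫ t in Ioc x y, -D t := by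
    rw [integral_neg, ← intervalIntegral.integral_of_le hxy,
      ← hsol.1 x hx y (hx.trans_le hxy) hxy, neg_sub]
  rw [h]
  refine (ofReal_integral_eq_lintegral_ofReal (intervalIntegrable hD hx hxy).1.neg ?_).symm
  exact ae_restrict_of_forall_mem measurableSet_Ioc fun t ht ↦
    neg_nonneg.2 (hsol.nonpos hD hanti (hx.trans ht.1))

/-- The second-order Taylor formula at infinity for a decreasing solution. -/
lemma ofReal_sub_limit_eq (hsol : IsIntegralSolution m lam (Ioi a) f D) (hlam : 0 < lam)
    (hm : ∀ K : Set ℝ, IsCompact K → K ⊆ Ioi a → m K < ⊤)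
    (hpos : ∀ x ∈ Ioi a, 0 < f x) (hanti : AntitoneOn f (Ioi a)) {α : ℝ}
    (hα : Tendsto f atTop (nhds α)) {x : ℝ} (hx : a < x) :
    ENNReal.ofReal (f x - α) = ENNReal.ofReal lam *
      ∫⁻ u in Ioi x, ENNReal.ofReal (u - x) * ENNReal.ofReal (f u) ∂m := by
  have := sigmaFinite_restrict_Ioi hm hx
  have hmeas : AEMeasurable (fun u ↦ ENNReal.ofReal (f u)) (m.restrict (Ioi x)) :=
    (aemeasurable_restrict_of_antitoneOn measurableSet_Ioi
      (hanti.mono (Ioi_subset_Ioi hx.le))).ennreal_ofReal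
  rw [hsol.ofReal_sub_eq_lintegral (hsol.monotoneOn hlam hpos) hanti hα hx,
    ← lintegral_Ioi_lintegral_Ioi m x hmeas, ← lintegral_const_mul' _ _ ENNReal.ofReal_ne_top]
  exact setLIntegral_congr_fun measurableSet_Ioi fun t ht ↦
    hsol.ofReal_neg_eq_lintegral hlam hm hpos hanti (hx.trans ht)

lemma integral_eq_sub_limit (hsol : IsIntegralSolution m lam (Ioi a) f D) (hlam : 0 < lam)
    (hm : ∀ K : Set ℝ, IsCompact K → K ⊆ Ioi a → m K < ⊤)
    (hpos : ∀ x ∈ Ioi a, 0 < f x) (hanti : AntitoneOn f (Ioi a)) {α : ℝ}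
    (hα : Tendsto f atTop (nhds α)) {x : ℝ} (hx : a < x) :
    lam * ∫ y in Ioi x, (y - x) * f y ∂m = f x - α := by
  have hle : α ≤ f x := le_of_tendsto hα (by
    filter_upwards [eventually_ge_atTop x] with y hy using hanti hx (hx.trans_le hy) hy)
  have hmeas : AEMeasurable f (m.restrict (Ioi x)) :=
    aemeasurable_restrict_of_antitoneOn measurableSet_Ioi (hanti.mono (Ioi_subset_Ioi hx.le))
  rw [integral_eq_lintegral_of_nonneg_ae
    (ae_restrict_of_forall_mem measurableSet_Ioi fun u hu ↦
      mul_nonneg (sub_nonneg.2 (le_of_lt hu)) (hpos u (hx.trans hu)).le)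
    ((aemeasurable_id'.sub_const x).mul hmeas).aestronglyMeasurable,
    ← ENNReal.toReal_ofReal (sub_nonneg.2 hle),
    hsol.ofReal_sub_limit_eq hlam hm hpos hanti hα hx, ENNReal.toReal_mul,
    ENNReal.toReal_ofReal hlam.le]
  congr 2
  exact setLIntegral_congr_fun measurableSet_Ioi fun u hu ↦
    ENNReal.ofReal_mul (sub_nonneg.2 (le_of_lt hu))

lemma lintegral_eq_top_of_limit_eq_zero (hsol : IsIntegralSolution m lam (Ioi a) f D)
    (hlam : 0 < lam) (hm : ∀ K : Set ℝ, IsCompact K → K ⊆ Ioi a → m K < ⊤)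
    (hpos : ∀ x ∈ Ioi a, 0 < f x) (hanti : AntitoneOn f (Ioi a))
    (h0 : Tendsto f atTop (nhds 0)) (r : ℝ) :
    ∫⁻ y in Ioi r, ENNReal.ofReal y ∂m = ⊤ := by
  by_contra hr
  have hlim : Tendsto (fun x ↦ ENNReal.ofReal lam * ∫⁻ u in Ioi x, ENNReal.ofReal u ∂m)
      atTop (nhds 0) := by
    simpa using ENNReal.Tendsto.const_mul (tendsto_lintegral_Ioi_atTop_zero m _ hr)
      (Or.inr (ENNReal.ofReal_ne_top (r := lam)))
  obtain ⟨x, hlt, hxa, hx0⟩ := ((hlim.eventually_lt_const zero_lt_one).and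
    ((eventually_gt_atTop a).and (eventually_ge_atTop 0))).exists
  have hf : 0 < f x := hpos x hxa
  have hbound : ENNReal.ofReal (f x) ≤
      (ENNReal.ofReal lam * ∫⁻ u in Ioi x, ENNReal.ofReal u ∂m) * ENNReal.ofReal (f x) := by
    have h := hsol.ofReal_sub_limit_eq hlam hm hpos hanti h0 hxa
    rw [sub_zero] at h
    refine h.trans_le ?_
    rw [mul_assoc, ← lintegral_mul_const' _ _ ENNReal.ofReal_ne_top]
    refine mul_le_mul' le_rfl (setLIntegral_mono' measurableSet_Ioi fun u hu ↦ ?_)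
    gcongr
    · linarith
    · exact hanti hxa (hxa.trans hu) (le_of_lt hu)
  refine hbound.not_gt ?_
  simpa using ENNReal.mul_lt_mul_left (ENNReal.ofReal_pos.2 hf).ne' ENNReal.ofReal_ne_top hlt

lemma exists_lintegral_ne_top (hsol : IsIntegralSolution m lam (Ioi a) f D)
    (hlam : 0 < lam) (hm : ∀ K : Set ℝ, IsCompact K → K ⊆ Ioi a → m K < ⊤)
    (hpos : ∀ x ∈ Ioi a, 0 < f x) (hanti : AntitoneOn f (Ioi a)) {α : ℝ}
    (hα : Tendsto f atTop (nhds α)) (hα0 : 0 < α) :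
    ∃ r ∈ Ioi a, ∫⁻ y in Ioi r, ENNReal.ofReal y ∂m ≠ ⊤ := by
  obtain ⟨x, hxa, hx0⟩ : ∃ x, a < x ∧ 0 ≤ x :=
    ⟨max a 0 + 1, by linarith [le_max_left a 0], by linarith [le_max_right a 0]⟩
  have hle : ∀ u, x < u → α ≤ f u := fun u hu ↦ le_of_tendsto hα (by
    filter_upwards [eventually_ge_atTop u] with y hy using
      hanti (hxa.trans hu) ((hxa.trans hu).trans_le hy) hy)
  have hfin : ∫⁻ u in Ioi x, ENNReal.ofReal (u - x) * ENNReal.ofReal (f u) ∂m ≠ ⊤ := by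
    intro htop
    have h := hsol.ofReal_sub_limit_eq hlam hm hpos hanti hα hxa
    rw [htop, ENNReal.mul_top (ENNReal.ofReal_pos.2 hlam).ne'] at h
    exact ENNReal.ofReal_ne_top h
  refine ⟨x + 1, show a < x + 1 by linarith, ne_top_of_le_ne_top
    (ENNReal.mul_ne_top (ENNReal.ofReal_ne_top (r := (1 + x) / α)) hfin) ?_⟩
  rw [← lintegral_const_mul' _ _ ENNReal.ofReal_ne_top]
  refine (setLIntegral_mono' measurableSet_Ioi fun u hu ↦ ?_).trans
    (lintegral_mono_set (Ioi_subset_Ioi (le_add_of_nonneg_right zero_le_one)))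
  have hu : x + 1 < u := hu
  rw [← ENNReal.ofReal_mul (by linarith), ← ENNReal.ofReal_mul (by positivity)]
  refine ENNReal.ofReal_le_ofReal ?_
  calc u ≤ (1 + x) * (u - x) := by nlinarith
    _ = (1 + x) / α * ((u - x) * α) := by field_simp
    _ ≤ (1 + x) / α * ((u - x) * f u) := by
      have := hle u (by linarith)
      have : 0 ≤ u - x := by linarith
      gcongr

end IsIntegralSolution

/-- **Lemma 4.2.** For a positive nonincreasing solution of `f'' = λ·f·m` on `(a,∞)`
with `λ > 0` and `α₊ := lim_{x→∞} f(x)`, the following are equivalent: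
(1) `α₊ = 0`; (2) `∫_{(r,∞)} y m(dy) = ∞` for all `r > a`;
(3) `λ ∫_{(x,∞)} (y − x) f(y) m(dy) = f(x)` for all `x > a`. -/
theorem integral_solution_decreasing_tfae
    (m : MeasureTheory.Measure ℝ) (a lam : ℝ) (hlam : 0 < lam)
    (hm : ∀ K : Set ℝ, IsCompact K → K ⊆ Set.Ioi a → m K < ⊤)
    (f D : ℝ → ℝ)
    (hsol : IsIntegralSolution m lam (Set.Ioi a) f D)
    (hpos : ∀ x ∈ Set.Ioi a, 0 < f x)
    (hanti : AntitoneOn f (Set.Ioi a))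
    (α : ℝ) (hα : Filter.Tendsto f Filter.atTop (nhds α)) :
    List.TFAE
      [α = 0,
       ∀ r ∈ Set.Ioi a, ∫⁻ y in Set.Ioi r, ENNReal.ofReal y ∂m = ⊤,
       ∀ x ∈ Set.Ioi a, lam * ∫ y in Set.Ioi x, (y - x) * f y ∂m = f x] := by
  have hα0 : 0 ≤ α := ge_of_tendsto hα (by
    filter_upwards [eventually_gt_atTop a] with x hx using (hpos x hx).le)
  tfae_have 1 → 2 := fun h r _ ↦
    hsol.lintegral_eq_top_of_limit_eq_zero hlam hm hpos hanti (h ▸ hα) r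
  tfae_have 2 → 1 := fun h ↦ by
    by_contra hne
    obtain ⟨r, hr, hr'⟩ := hsol.exists_lintegral_ne_top hlam hm hpos hanti hα
      (lt_of_le_of_ne hα0 (Ne.symm hne))
    exact hr' (h r hr)
  tfae_have 1 → 3 := fun h x hx ↦ by
    rw [hsol.integral_eq_sub_limit hlam hm hpos hanti hα hx, h, sub_zero]
  tfae_have 3 → 1 := fun h ↦ by
    have hx : a < a + 1 := lt_add_one a
    linarith [h _ hx, hsol.integral_eq_sub_limit hlam hm hpos hanti hα hx]
  tfae_finish
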